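/- arXiv:1010.5917 — 4 statements merged into one kernel-verified Lean document; each statement's English description precedes it below -/
import Mathlib

section
/- Let n, d ≥ 1, T > 0, let q be a unit vector in ℝⁿ, and let g¹, g² : [0,T] × ℝⁿ × ℝ^{n×d} → ℝⁿ be functions that are Lipschitz in (y,z) uniformly in t with some constant μ > 0. Suppose there exists a constant C > 0 such that for all t ∈ [0,T], y, y' ∈ ℝⁿ and z, z' ∈ ℝ^{n×d}: −4⟨y,q⟩⁻ ⟨q, g¹(t, y + ⟨y,q⟩⁻ q + y', z) − g²(t, y', z')⟩ ≤ 2·1_{⟨y,q⟩<0} Σ_{i,j=1}^n q_i q_j ⟨z_i − z'_i, z_j − z'_j⟩ + C (⟨y,q⟩⁻)². Then for all t ∈ [0,T], y ∈ ℝⁿ, z ∈ ℝ^{n×d}: ⟨q, g¹(t,y,z)⟩ ≥ ⟨q, g²(t,y,z)⟩. -/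
open scoped InnerProductSpace BigOperators

/-- Theorem 3.2 (Theorem `th22`): if the comparison condition (ii) holds for the pair
`(g¹, g²)` with a unit vector `q`, then `⟨q, g¹(t,y,z)⟩ ≥ ⟨q, g²(t,y,z)⟩` for all
`t ∈ [0,T]`, `y ∈ ℝⁿ`, `z ∈ ℝ^{n×d}`.  A matrix `z ∈ ℝ^{n×d}` is modeled as an
element of `EuclideanSpace ℝ (Fin n × Fin d)` (Frobenius norm); its `i`-th row is
`fun k => z (i, k)`. -/
theorem stmt8 (n d : ℕ) (hn : 1 ≤ n) (hd : 1 ≤ d) (T : ℝ) (hT : 0 < T)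
    (q : EuclideanSpace ℝ (Fin n)) (hq : ‖q‖ = 1) (μ : ℝ) (hμ : 0 < μ)
    (g1 g2 : ℝ → EuclideanSpace ℝ (Fin n) → EuclideanSpace ℝ (Fin n × Fin d) →
      EuclideanSpace ℝ (Fin n))
    (hg1 : ∀ t ∈ Set.Icc (0:ℝ) T, ∀ y y' z z',
      ‖g1 t y z - g1 t y' z'‖ ≤ μ * (‖y - y'‖ + ‖z - z'‖))
    (hg2 : ∀ t ∈ Set.Icc (0:ℝ) T, ∀ y y' z z',
      ‖g2 t y z - g2 t y' z'‖ ≤ μ * (‖y - y'‖ + ‖z - z'‖))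
    (C : ℝ) (hC : 0 < C)
    (hcomp : ∀ t ∈ Set.Icc (0:ℝ) T, ∀ (y y' : EuclideanSpace ℝ (Fin n))
      (z z' : EuclideanSpace ℝ (Fin n × Fin d)),
      -4 * max (-⟪y, q⟫_ℝ) 0 *
          ⟪q, g1 t (y + (max (-⟪y, q⟫_ℝ) 0) • q + y') z - g2 t y' z'⟫_ℝ ≤
        2 * (if ⟪y, q⟫_ℝ < 0 then (1:ℝ) else 0) *
            (∑ i : Fin n, ∑ j : Fin n, q i * q j *
              (∑ k : Fin d, (z (i, k) - z' (i, k)) * (z (j, k) - z' (j, k)))) +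
          C * (max (-⟪y, q⟫_ℝ) 0) ^ 2) :
    ∀ t ∈ Set.Icc (0:ℝ) T, ∀ (y : EuclideanSpace ℝ (Fin n))
      (z : EuclideanSpace ℝ (Fin n × Fin d)),
      ⟪q, g1 t y z⟫_ℝ ≥ ⟪q, g2 t y z⟫_ℝ := by
  intro t ht y z
  by_contra! hlt
  set D := ⟪q, g1 t y z⟫_ℝ - ⟪q, g2 t y z⟫_ℝ with hD
  have hDneg : D < 0 := sub_neg.mpr hlt
  obtain ⟨s, hs, hCs⟩ : ∃ s : ℝ, 0 < s ∧ C * s = -2 * D :=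
    ⟨-2 * D / C, div_pos (by linarith) hC, by field_simp⟩
  have hinner : ⟪(-s) • q, q⟫_ℝ = -s := by
    rw [real_inner_smul_left, real_inner_self_eq_norm_sq, hq]
    ring
  have h := hcomp t ht ((-s) • q) y z z
  have hshift : (-s) • q + s • q + y = y := by simp
  rw [hinner, neg_neg, max_eq_left hs.le, hshift, inner_sub_right, ← hD] at h
  simp only [sub_self, mul_zero, Finset.sum_const_zero, zero_add] at h
  nlinarith [mul_pos hs (neg_pos.mpr hDneg)]
end

section
/- Let n, d ≥ 1, T > 0, fix i ∈ {1,…,n}, and let g¹, g² : [0,T] × ℝⁿ × ℝ^{n×d} → ℝⁿ be Lipschitz in (y,z) uniformly in t with some constant μ > 0. Suppose there exist constants C, C' > 0 such that the comparison inequality −4⟨y,q⟩⁻ ⟨q, g¹(t, y + ⟨y,q⟩⁻ q + y', z) − g²(t, y', z')⟩ ≤ 2·1_{⟨y,q⟩<0} Σ_{k,l=1}^n q_k q_l ⟨z_k − z'_k, z_l − z'_l⟩ + C (⟨y,q⟩⁻)² holds for all t, y, y', z, z' with q = e^i (constant C), and also with q = −e^i (constant C'). Then g¹_i(t,y,z)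 = g²_i(t,y,z) for all t ∈ [0,T], y ∈ ℝⁿ, z ∈ ℝ^{n×d}, where g_i denotes the i-th component of g. -/
open scoped InnerProductSpace BigOperators

/-- Corollary `co23`: if the comparison condition (ii) holds (with some positive
constant) both for `q = e^i` and for `q = −e^i`, then the `i`-th components of
`g¹` and `g²` coincide.  A matrix `z ∈ ℝ^{n×d}` is modeled as an element of
`EuclideanSpace ℝ (Fin n × Fin d)`; its `i`-th row is `fun k => z (i, k)`. -/
theorem stmt9 (n d : ℕ) (hn : 1 ≤ n) (hd : 1 ≤ d) (T : ℝ) (hT : 0 < T)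
    (i : Fin n) (μ : ℝ) (hμ : 0 < μ)
    (g1 g2 : ℝ → EuclideanSpace ℝ (Fin n) → EuclideanSpace ℝ (Fin n × Fin d) →
      EuclideanSpace ℝ (Fin n))
    (hg1 : ∀ t ∈ Set.Icc (0:ℝ) T, ∀ y y' z z',
      ‖g1 t y z - g1 t y' z'‖ ≤ μ * (‖y - y'‖ + ‖z - z'‖))
    (hg2 : ∀ t ∈ Set.Icc (0:ℝ) T, ∀ y y' z z',
      ‖g2 t y z - g2 t y' z'‖ ≤ μ * (‖y - y'‖ + ‖z - z'‖))
    (hcomp : ∀ q : EuclideanSpace ℝ (Fin n),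
      (q = EuclideanSpace.single i (1:ℝ) ∨ q = -EuclideanSpace.single i (1:ℝ)) →
      ∃ C > (0:ℝ), ∀ t ∈ Set.Icc (0:ℝ) T, ∀ (y y' : EuclideanSpace ℝ (Fin n))
        (z z' : EuclideanSpace ℝ (Fin n × Fin d)),
        -4 * max (-⟪y, q⟫_ℝ) 0 *
            ⟪q, g1 t (y + (max (-⟪y, q⟫_ℝ) 0) • q + y') z - g2 t y' z'⟫_ℝ ≤
          2 * (if ⟪y, q⟫_ℝ < 0 then (1:ℝ) else 0) *
              (∑ k : Fin n, ∑ l : Fin n, q k * q l *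
                (∑ m : Fin d, (z (k, m) - z' (k, m)) * (z (l, m) - z' (l, m)))) +
            C * (max (-⟪y, q⟫_ℝ) 0) ^ 2) :
    ∀ t ∈ Set.Icc (0:ℝ) T, ∀ (y : EuclideanSpace ℝ (Fin n))
      (z : EuclideanSpace ℝ (Fin n × Fin d)),
      g1 t y z i = g2 t y z i := by
  intro t ht y z
  have key : ∀ q : EuclideanSpace ℝ (Fin n),
      (q = EuclideanSpace.single i (1:ℝ) ∨ q = -EuclideanSpace.single i (1:ℝ)) →
      0 ≤ ⟪q, g1 t y z - g2 t y z⟫_ℝ := by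
    intro q hq
    obtain ⟨C, hC, h⟩ := hcomp q hq
    have hqq : ⟪q, q⟫_ℝ = 1 := by
      rw [real_inner_self_eq_norm_sq]
      rcases hq with rfl | rfl <;> simp
    by_contra! hneg
    set a := ⟪q, g1 t y z - g2 t y z⟫_ℝ with ha
    have hε : 0 < -a / C := div_pos (neg_pos.mpr hneg) hC
    set ε := -a / C with hεdef
    have hCε : C * ε = -a := by rw [hεdef]; field_simp
    have h1 := h t ht (-(ε • q)) y z z
    have hmax : max (-⟪-(ε • q), q⟫_ℝ) 0 = ε := by
      rw [inner_neg_left, real_inner_smul_left, hqq, neg_neg, mul_one, max_eq_left hε.le]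
    rw [hmax, neg_add_cancel, zero_add, ← ha] at h1
    simp only [sub_self, mul_zero, Finset.sum_const_zero, zero_add] at h1
    nlinarith [mul_pos hε (neg_pos.mpr hneg)]
  have h1 := key _ (Or.inl rfl)
  have h2 := key _ (Or.inr rfl)
  rw [inner_neg_left] at h2
  simp only [EuclideanSpace.inner_single_left, map_one, one_mul, PiLp.sub_apply] at h1 h2
  linarith
end

section
/- Let n, d ≥ 1, T > 0, fix i ∈ {1,…,n}, and let g : [0,T] × ℝⁿ × ℝ^{n×d} → ℝⁿ be Lipschitz in (y,z) uniformly in t with constant μ > 0. Then the following are equivalent: (1) there exists a constant C > 0 such that for all t ∈ [0,T], y, y' ∈ ℝⁿ, z, z' ∈ ℝ^{n×d}: −4 y_i⁻ (g_i(t, y + y_i⁻ e^i + y', z) − g_i(t, y', z')) ≤ 2·1_{y_i<0} |z_i − z'_i|² + C (y_i⁻)²; (2) for every t ∈ [0,T], the i-th component g_i(t,y,z) depends only on y_i and z_i, i.e. g_i(t,y,z) = g_i(t,ỹ,z̃) whenever y_i = ỹ_i and z_i = z̃_i. Moreover, when (2) holds, (1) holds with C = 2μ². -/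
open scoped BigOperators

/-- Under the comparison condition, `f y' z' ≤ f y z` whenever the arguments agree in the `i`-th
coordinate and in the `i`-th row. -/
lemma le_of_comparison {n d : ℕ} {i : Fin n} {C : ℝ}
    {f : EuclideanSpace ℝ (Fin n) → EuclideanSpace ℝ (Fin n × Fin d) → ℝ}
    (hf : ∀ y y' z z', -4 * max (-(y i)) 0 *
        (f (y + (max (-(y i)) 0) • EuclideanSpace.single i (1:ℝ) + y') z - f y' z') ≤
      2 * (if y i < 0 then (1:ℝ) else 0) * (∑ k : Fin d, (z (i, k) - z' (i, k)) ^ 2) +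
        C * (max (-(y i)) 0) ^ 2)
    {y y' : EuclideanSpace ℝ (Fin n)} {z z' : EuclideanSpace ℝ (Fin n × Fin d)}
    (hy : y i = y' i) (hz : ∀ k, z (i, k) = z' (i, k)) :
    f y' z' ≤ f y z := by
  have key : ∀ ε > 0, f y' z' - f y z ≤ C / 4 * ε := by
    intro ε hε
    have h := hf (y - y' - ε • EuclideanSpace.single i (1:ℝ)) y' z z'
    have hi : (y - y' - ε • EuclideanSpace.single i (1:ℝ)) i = -ε := by simp [hy]
    have hs : y - y' - ε • EuclideanSpace.single i (1:ℝ) +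
        ε • EuclideanSpace.single i (1:ℝ) + y' = y := by abel
    have hsum : ∑ k : Fin d, (z (i, k) - z' (i, k)) ^ 2 = 0 := by simp [hz]
    rw [hi, neg_neg, max_eq_left hε.le, hs, hsum] at h
    refine le_of_mul_le_mul_left ?_ hε
    linarith
  have hlim : Filter.Tendsto (fun ε : ℝ => C / 4 * ε) (nhdsWithin 0 (Set.Ioi 0)) (nhds 0) := by
    have : Filter.Tendsto (fun ε : ℝ => C / 4 * ε) (nhds 0) (nhds (C / 4 * 0)) :=
      (continuous_const.mul continuous_id).tendsto 0
    rw [mul_zero] at this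
    exact this.mono_left nhdsWithin_le_nhds
  have := ge_of_tendsto hlim (eventually_nhdsWithin_of_forall key)
  linarith

/-- A function depending only on the `i`-th coordinate and the `i`-th row, and Lipschitz in the
matrix argument with constant `μ`, satisfies the comparison condition with constant `2 * μ ^ 2`. -/
lemma comparison_of_depends_only {n d : ℕ} {i : Fin n} {μ : ℝ}
    {f : EuclideanSpace ℝ (Fin n) → EuclideanSpace ℝ (Fin n × Fin d) → ℝ}
    (hLip : ∀ y z z', |f y z - f y z'| ≤ μ * ‖z - z'‖)
    (hf : ∀ y y' z z', y i = y' i → (∀ k : Fin d, z (i, k) = z' (i, k)) → f y z = f y' z')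
    (y y' : EuclideanSpace ℝ (Fin n)) (z z' : EuclideanSpace ℝ (Fin n × Fin d)) :
    -4 * max (-(y i)) 0 *
        (f (y + (max (-(y i)) 0) • EuclideanSpace.single i (1:ℝ) + y') z - f y' z') ≤
      2 * (if y i < 0 then (1:ℝ) else 0) * (∑ k : Fin d, (z (i, k) - z' (i, k)) ^ 2) +
        (2 * μ ^ 2) * (max (-(y i)) 0) ^ 2 := by
  rcases lt_or_ge (y i) 0 with hneg | hpos
  · rw [max_eq_left (by linarith), if_pos hneg]
    let w : EuclideanSpace ℝ (Fin n × Fin d) :=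
      WithLp.toLp 2 fun p => if p.1 = i then z p else z' p
    have hw : f (y + (-(y i)) • EuclideanSpace.single i (1:ℝ) + y') z = f y' w :=
      hf _ _ _ _ (by simp) (by simp [w])
    have hnorm : ‖w - z'‖ ^ 2 = ∑ k : Fin d, (z (i, k) - z' (i, k)) ^ 2 := by
      rw [EuclideanSpace.norm_sq_eq, Fintype.sum_prod_type,
        Finset.sum_eq_single i (fun j _ hj => by simp [w, hj]) (by simp)]
      simp [w]
    have hl := neg_le_of_abs_le (hLip y' w z')
    rw [hw, ← hnorm]
    nlinarith [sq_nonneg (‖w - z'‖ - μ * -(y i)),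
      mul_le_mul_of_nonneg_left hl (by linarith : 0 ≤ -(y i))]
  · simp [max_eq_right (neg_nonpos.mpr hpos), not_lt.mpr hpos]

/-- Remark `re3`: for `g¹ = g² = g` and `q = e^i`, the comparison condition (v)
holds for some constant `C > 0` if and only if the `i`-th component of `g` depends
only on `y_i` and on the `i`-th row `z_i`; moreover, in that case the condition
holds with `C = 2μ²`.  A matrix `z ∈ ℝ^{n×d}` is modeled as an element of
`EuclideanSpace ℝ (Fin n × Fin d)`; its `i`-th row is `fun k => z (i, k)`. -/
theorem stmt11 (n d : ℕ) (hn : 1 ≤ n) (hd : 1 ≤ d) (T : ℝ) (hT : 0 < T)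
    (i : Fin n) (μ : ℝ) (hμ : 0 < μ)
    (g : ℝ → EuclideanSpace ℝ (Fin n) → EuclideanSpace ℝ (Fin n × Fin d) →
      EuclideanSpace ℝ (Fin n))
    (hg : ∀ t ∈ Set.Icc (0:ℝ) T, ∀ y y' z z',
      ‖g t y z - g t y' z'‖ ≤ μ * (‖y - y'‖ + ‖z - z'‖)) :
    ((∃ C > (0:ℝ), ∀ t ∈ Set.Icc (0:ℝ) T, ∀ (y y' : EuclideanSpace ℝ (Fin n))
        (z z' : EuclideanSpace ℝ (Fin n × Fin d)),
        -4 * max (-(y i)) 0 *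
            (g t (y + (max (-(y i)) 0) • EuclideanSpace.single i (1:ℝ) + y') z i -
              g t y' z' i) ≤
          2 * (if y i < 0 then (1:ℝ) else 0) *
              (∑ k : Fin d, (z (i, k) - z' (i, k)) ^ 2) +
            C * (max (-(y i)) 0) ^ 2) ↔
      (∀ t ∈ Set.Icc (0:ℝ) T, ∀ (y yt : EuclideanSpace ℝ (Fin n))
        (z zt : EuclideanSpace ℝ (Fin n × Fin d)),
        y i = yt i → (∀ k : Fin d, z (i, k) = zt (i, k)) →
        g t y z i = g t yt zt i)) ∧
    ((∀ t ∈ Set.Icc (0:ℝ) T, ∀ (y yt : EuclideanSpace ℝ (Fin n))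
        (z zt : EuclideanSpace ℝ (Fin n × Fin d)),
        y i = yt i → (∀ k : Fin d, z (i, k) = zt (i, k)) →
        g t y z i = g t yt zt i) →
      ∀ t ∈ Set.Icc (0:ℝ) T, ∀ (y y' : EuclideanSpace ℝ (Fin n))
        (z z' : EuclideanSpace ℝ (Fin n × Fin d)),
        -4 * max (-(y i)) 0 *
            (g t (y + (max (-(y i)) 0) • EuclideanSpace.single i (1:ℝ) + y') z i -
              g t y' z' i) ≤
          2 * (if y i < 0 then (1:ℝ) else 0) *
              (∑ k : Fin d, (z (i, k) - z' (i, k)) ^ 2) +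
            (2 * μ ^ 2) * (max (-(y i)) 0) ^ 2) := by
  have hcomp : ∀ t ∈ Set.Icc (0:ℝ) T, ∀ y z z', |g t y z i - g t y z' i| ≤ μ * ‖z - z'‖ := by
    intro t ht y z z'
    have h := (PiLp.norm_apply_le (g t y z - g t y z') i).trans (hg t ht y y z z')
    simpa using h
  refine ⟨⟨?_, fun h => ⟨2 * μ ^ 2, by positivity, fun t ht =>
    comparison_of_depends_only (hcomp t ht) (h t ht)⟩⟩, fun h t ht =>
    comparison_of_depends_only (hcomp t ht) (h t ht)⟩
  rintro ⟨C, -, hC⟩ t ht y yt z zt hy hz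
  exact le_antisymm
    (le_of_comparison (f := fun y z => g t y z i) (hC t ht) hy.symm fun k => (hz k).symm)
    (le_of_comparison (f := fun y z => g t y z i) (hC t ht) hy hz)
end

section
/- Let n = 2, d ≥ 1, T > 0, and define g¹, g² : [0,T] × ℝ² × ℝ^{2×d} → ℝ² by g¹(t,y,z) = (y₁ + y₂, t) and g²(t,y,z) = (y₁ + y₂ − 1, t). Then g¹₁(t,y,z) ≥ g²₁(t,y,z) for every (t,y,z), but there exists NO constant C > 0 such that for all t ∈ [0,T], y, y' ∈ ℝ², z, z' ∈ ℝ^{2×d}: −4 y₁⁻ (g¹₁(t, y + y₁⁻ e¹ + y', z) − g²₁(t, y', z')) ≤ 2·1_{y₁<0} |z₁ − z'₁|² + C (y₁⁻)². In particular, setting y = (y₁, −3) with y₁ < 0, z = z', any such C would have to satisfy C > −8/y₁ for all y₁ < 0, which is impossible. -/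
open scoped BigOperators

/-- Example `ex1`: with `g¹(t,y,z) = (y₁ + y₂, t)` and `g²(t,y,z) = (y₁ + y₂ − 1, t)`,
the first components satisfy `g¹₁ ≥ g²₁` everywhere, yet no constant `C > 0` makes
the comparison condition (v) (for `i = 1`, i.e. index `0`) hold.  A matrix
`z ∈ ℝ^{2×d}` is modeled as an element of `EuclideanSpace ℝ (Fin 2 × Fin d)`;
its first row is `fun k => z (0, k)`. -/
theorem stmt12 (d : ℕ) (hd : 1 ≤ d) (T : ℝ) (hT : 0 < T)
    (g1 g2 : ℝ → EuclideanSpace ℝ (Fin 2) → EuclideanSpace ℝ (Fin 2 × Fin d) →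
      EuclideanSpace ℝ (Fin 2))
    (hg1 : ∀ t y z, g1 t y z 0 = y 0 + y 1 ∧ g1 t y z 1 = t)
    (hg2 : ∀ t y z, g2 t y z 0 = y 0 + y 1 - 1 ∧ g2 t y z 1 = t) :
    (∀ t ∈ Set.Icc (0:ℝ) T, ∀ (y : EuclideanSpace ℝ (Fin 2))
      (z : EuclideanSpace ℝ (Fin 2 × Fin d)), g1 t y z 0 ≥ g2 t y z 0) ∧
    ¬ ∃ C > (0:ℝ), ∀ t ∈ Set.Icc (0:ℝ) T, ∀ (y y' : EuclideanSpace ℝ (Fin 2))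
      (z z' : EuclideanSpace ℝ (Fin 2 × Fin d)),
      -4 * max (-(y 0)) 0 *
          (g1 t (y + (max (-(y 0)) 0) • EuclideanSpace.single 0 (1:ℝ) + y') z 0 -
            g2 t y' z' 0) ≤
        2 * (if y 0 < 0 then (1:ℝ) else 0) *
            (∑ k : Fin d, (z (0, k) - z' (0, k)) ^ 2) +
          C * (max (-(y 0)) 0) ^ 2 := by
  refine ⟨fun t _ y z => ?_, ?_⟩
  · rw [(hg1 t y z).1, (hg2 t y z).1]
    linarith
  · rintro ⟨C, hC, h⟩
    have hinv : 0 < C⁻¹ := inv_pos.mpr hC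
    have key := h 0 ⟨le_rfl, hT.le⟩ !₂[-C⁻¹, -3] 0 0 0
    rw [(hg1 _ _ _).1, (hg2 _ _ _).1] at key
    simp only [PiLp.add_apply, PiLp.smul_apply, PiLp.zero_apply,
      PiLp.single_apply, Matrix.cons_val_zero, Matrix.cons_val_one, neg_neg,
      max_eq_left hinv.le, smul_eq_mul, if_true, one_ne_zero, if_false, sub_self] at key
    have hCC : C * (C ^ 2)⁻¹ = C⁻¹ := by field_simp
    norm_num at key
    linarith
end
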